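/- Let φ : (0,1) → ℝ be measurable with C_φ := ∫₀¹ |φ(σ)|/σ dσ < ∞, and let f ∈ L¹(ℝ) be such that its Poisson maximal function M_P f is integrable (i.e., f ∈ H¹(ℝ) with ‖f‖_{H¹} = ‖M_P f‖_{L¹}). Define Tf(x) = ∫₀¹ φ(σ) f(xσ) dσ. Then M_P(Tf) is integrable and ‖Tf‖_{H¹} ≤ C_φ ‖f‖_{H¹}. -/

import Mathlib

open MeasureTheory Set

noncomputable def P (t x : ℝ) : ℝ := (1 / Real.pi) * t / (t ^ 2 + x ^ 2)

noncomputable def conv (g f : ℝ → ℝ) (x : ℝ) : ℝ := ∫ y, g (x - y) * f y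

noncomputable def MP (f : ℝ → ℝ) (x : ℝ) : ℝ :=
  ⨆ t : {t : ℝ // 0 < t}, |conv (P t.1) f x|

section helpers

open Filter
open scoped ENNReal Topology

lemma P_nonneg {t : ℝ} (ht : 0 < t) (x : ℝ) : 0 ≤ P t x := by
  unfold P; positivity

lemma P_le {t : ℝ} (ht : 0 < t) (x : ℝ) : P t x ≤ (1 / Real.pi) * t / t ^ 2 := by
  unfold P
  have := Real.pi_pos
  gcongr
  nlinarith [sq_nonneg x]

lemma P_cont {t : ℝ} (ht : 0 < t) : Continuous (P t) := by
  unfold P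
  refine Continuous.div (by fun_prop) (by fun_prop) (fun x => ?_)
  positivity

lemma P_lintegral {t : ℝ} (ht : 0 < t) (x : ℝ) :
    ∫⁻ y, ENNReal.ofReal (P t (x - y)) = 1 := by
  have h := ProbabilityTheory.lintegral_cauchyPDF_eq_one x (γ := t.toNNReal)
    (by simpa using ht)
  rw [← h]
  refine lintegral_congr fun y => ?_
  rw [ProbabilityTheory.cauchyPDF_def, ProbabilityTheory.cauchyPDFReal_def]
  congr 1
  simp only [P, Real.coe_toNNReal t ht.le]
  rw [show (y - x) ^ 2 + t ^ 2 = t ^ 2 + (x - y) ^ 2 by ring]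
  ring

/-- minus the derivative of the Poisson kernel -/
noncomputable def wP (t s : ℝ) : ℝ := (1 / Real.pi) * t * (2 * s) / (t ^ 2 + s ^ 2) ^ 2

lemma wP_meas (t : ℝ) : Measurable (wP t) := by
  unfold wP; fun_prop

lemma P_layer {t : ℝ} (ht : 0 < t) {a : ℝ} (ha : 0 ≤ a) :
    ENNReal.ofReal (P t a) = ∫⁻ s in Ioi a, ENNReal.ofReal (wP t s) := by
  have hd : ∀ x ∈ Ici a, HasDerivAt (fun s => - P t s) (wP t x) x := by
    intro x _
    have hne : t ^ 2 + x ^ 2 ≠ 0 := by positivity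
    have h1 : HasDerivAt (fun s : ℝ => t ^ 2 + s ^ 2) (2 * x) x := by
      simpa using ((hasDerivAt_id x).pow 2).const_add (t ^ 2)
    have h2 := ((hasDerivAt_const x ((1 / Real.pi) * t)).div h1 hne).neg
    refine h2.congr_deriv ?_
    unfold wP
    ring
  have hpos : ∀ x ∈ Ioi a, 0 ≤ wP t x := by
    intro x hx
    have : 0 ≤ x := ha.trans (le_of_lt hx)
    unfold wP; positivity
  have hlim : Tendsto (fun s => - P t s) atTop (𝓝 0) := by
    have : Tendsto (fun s : ℝ => t ^ 2 + s ^ 2) atTop atTop :=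
      tendsto_atTop_add_const_left _ _ (tendsto_pow_atTop two_ne_zero)
    simpa [P] using (this.const_div_atTop ((1 / Real.pi) * t)).neg
  have hI := integral_Ioi_of_hasDerivAt_of_nonneg' hd hpos hlim
  have hint := integrableOn_Ioi_deriv_of_nonneg' hd hpos hlim
  rw [← ofReal_integral_eq_lintegral_ofReal hint
    ((ae_restrict_iff' measurableSet_Ioi).2 (ae_of_all _ hpos)), hI]
  simp

lemma layer {t : ℝ} (ht : 0 < t) (x : ℝ) (h : ℝ → ℝ≥0∞) (hh : Measurable h) :
    ∫⁻ y, ENNReal.ofReal (P t (x - y)) * h y =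
      ∫⁻ s in Ioi (0:ℝ), ENNReal.ofReal (wP t s) * ∫⁻ y in Metric.ball x s, h y := by
  have hw := wP_meas t
  have hset : MeasurableSet {p : ℝ × ℝ | dist p.1 x < p.2} :=
    measurableSet_lt (by fun_prop) (by fun_prop)
  have e1 : ∀ y, ENNReal.ofReal (P t (x - y)) * h y =
      ∫⁻ s in Ioi (0:ℝ), {p : ℝ × ℝ | dist p.1 x < p.2}.indicator
        (fun p => ENNReal.ofReal (wP t p.2) * h p.1) (y, s) := by
    intro y
    have : P t (x - y) = P t (dist y x) := by
      unfold P
      rw [Real.dist_eq, sq_abs]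
      congr 2; ring
    rw [this, P_layer ht dist_nonneg, ← lintegral_mul_const _ (by fun_prop)]
    rw [← lintegral_indicator measurableSet_Ioi, ← lintegral_indicator measurableSet_Ioi]
    refine lintegral_congr fun s => ?_
    by_cases hs : dist y x < s
    · have : 0 < s := dist_nonneg.trans_lt hs
      simp [indicator, hs, this]
    · simp [indicator, hs]
  have e2 : ∀ s, ENNReal.ofReal (wP t s) * ∫⁻ y in Metric.ball x s, h y =
      ∫⁻ y, {p : ℝ × ℝ | dist p.1 x < p.2}.indicator
        (fun p => ENNReal.ofReal (wP t p.2) * h p.1) (y, s) := by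
    intro s
    rw [← lintegral_const_mul _ hh, ← lintegral_indicator Metric.isOpen_ball.measurableSet]
    refine lintegral_congr fun y => ?_
    simp [indicator]
  simp_rw [e1, e2]
  refine lintegral_lintegral_swap ?_
  refine (Measurable.indicator ?_ hset).aemeasurable
  fun_prop

/-- extended-valued maximal function -/
noncomputable def MPE (f : ℝ → ℝ) (x : ℝ) : ℝ≥0∞ :=
  ⨆ t : {t : ℝ // 0 < t}, ENNReal.ofReal |conv (P t.1) f x|

lemma MP_eq (f : ℝ → ℝ) (x : ℝ) : MP f x = (MPE f x).toReal := by
  unfold MP MPE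
  rw [ENNReal.toReal_iSup (fun _ => ENNReal.ofReal_ne_top)]
  simp

lemma MPE_meas (f : ℝ → ℝ) (hf : Integrable f) : Measurable (MPE f) := by
  apply LowerSemicontinuous.measurable
  refine lowerSemicontinuous_iSup fun t => Continuous.lowerSemicontinuous ?_
  refine ENNReal.continuous_ofReal.comp (continuous_abs.comp ?_)
  have hc := P_cont t.2
  unfold conv
  refine continuous_of_dominated (bound := fun y => ((1 / Real.pi) * t.1 / t.1 ^ 2) * |f y|)
    (fun x => ?_) (fun x => ?_) ?_ ?_
  · exact (hc.comp (by fun_prop : Continuous fun y => x - y)).aestronglyMeasurable.mul hf.1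
  · refine ae_of_all _ fun y => ?_
    rw [norm_mul, Real.norm_of_nonneg (P_nonneg t.2 _), Real.norm_eq_abs]
    exact mul_le_mul_of_nonneg_right (P_le t.2 _) (abs_nonneg _)
  · exact hf.abs.const_mul _
  · exact ae_of_all _ fun y =>
      (hc.comp (by fun_prop : Continuous fun x => x - y)).mul continuous_const

lemma MPE_finite (f : ℝ → ℝ) (hfm : Measurable f) (hf : Integrable f) :
    ∀ᵐ x, MPE f x < ∞ := by
  have hh : Measurable fun y => ‖f y‖ₑ := hfm.enorm
  have hfin : ∫⁻ y, ‖f y‖ₑ ≠ ∞ := hf.2.ne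
  filter_upwards [(Besicovitch.vitaliFamily (volume : Measure ℝ)).ae_tendsto_lintegral_div
    hh.aemeasurable hfin] with x hx
  have hx' := hx.comp (Besicovitch.tendsto_filterAt volume x)
  have hev : ∀ᶠ r in 𝓝[>] (0:ℝ),
      (∫⁻ y in Metric.closedBall x r, ‖f y‖ₑ) / volume (Metric.closedBall x r) < ‖f x‖ₑ + 1 :=
    hx'.eventually_lt_const (ENNReal.lt_add_right enorm_ne_top one_ne_zero)
  obtain ⟨δ, hδ, hδ'⟩ := mem_nhdsGT_iff_exists_Ioo_subset.1 hev
  have hδ0 : (0:ℝ) < δ := hδ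
  set C : ℝ≥0∞ := (‖f x‖ₑ + 1) + (∫⁻ y, ‖f y‖ₑ) / ENNReal.ofReal (2 * δ) with hC
  have hCfin : C < ∞ := by
    refine ENNReal.add_lt_top.2 ⟨by simp, ENNReal.div_lt_top hfin ?_⟩
    simpa using hδ0
  have key : ∀ s ∈ Ioi (0:ℝ), ∫⁻ y in Metric.ball x s, ‖f y‖ₑ ≤
      C * ∫⁻ y in Metric.ball x s, 1 := by
    intro s hs
    have hs0 : (0:ℝ) < s := hs
    rw [setLIntegral_one, Real.volume_ball]
    by_cases hsd : s < δ
    · have h0 : (∫⁻ y in Metric.closedBall x s, ‖f y‖ₑ) / volume (Metric.closedBall x s) <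
          ‖f x‖ₑ + 1 := hδ' ⟨hs, hsd⟩
      have h1 := h0.le
      rw [Real.volume_closedBall, ENNReal.div_le_iff (by simpa using hs0) ENNReal.ofReal_ne_top]
        at h1
      refine (lintegral_mono_set Metric.ball_subset_closedBall).trans (h1.trans ?_)
      gcongr
      exact le_self_add
    · push Not at hsd
      calc ∫⁻ y in Metric.ball x s, ‖f y‖ₑ ≤ ∫⁻ y, ‖f y‖ₑ := setLIntegral_le_lintegral _ _
        _ = (∫⁻ y, ‖f y‖ₑ) / ENNReal.ofReal (2 * δ) * ENNReal.ofReal (2 * δ) := by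
          rw [ENNReal.div_mul_cancel (by simpa using hδ0) ENNReal.ofReal_ne_top]
        _ ≤ C * ENNReal.ofReal (2 * s) := by
          gcongr
          exact le_add_self
  refine lt_of_le_of_lt (iSup_le fun t => ?_) hCfin
  calc ENNReal.ofReal |conv (P t.1) f x| = ‖conv (P t.1) f x‖ₑ := by
        rw [Real.enorm_eq_ofReal_abs]
    _ ≤ ∫⁻ y, ‖P t.1 (x - y) * f y‖ₑ := enorm_integral_le_lintegral_enorm _
    _ = ∫⁻ y, ENNReal.ofReal (P t.1 (x - y)) * ‖f y‖ₑ := by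
        refine lintegral_congr fun y => ?_
        rw [enorm_mul, Real.enorm_of_nonneg (P_nonneg t.2 _)]
    _ = _ := layer t.2 x _ hh
    _ ≤ ∫⁻ s in Ioi (0:ℝ), C * (ENNReal.ofReal (wP t.1 s) * ∫⁻ y in Metric.ball x s, 1) := by
        refine setLIntegral_mono' measurableSet_Ioi fun s hs => ?_
        rw [mul_left_comm]
        exact mul_le_mul_right (key s hs) _
    _ = C * ∫⁻ s in Ioi (0:ℝ), (ENNReal.ofReal (wP t.1 s) * ∫⁻ y in Metric.ball x s, 1) :=
        lintegral_const_mul' _ _ hCfin.ne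
    _ = C := by
        rw [← layer t.2 x (fun _ => 1) measurable_const]
        simp [P_lintegral t.2]

lemma lint_scale (h : ℝ → ℝ≥0∞) (hh : Measurable h) {σ : ℝ} (hσ : 0 < σ) :
    ∫⁻ y, h (y * σ) = ENNReal.ofReal σ⁻¹ * ∫⁻ y, h y := by
  rw [← lintegral_map hh (by fun_prop : Measurable fun y : ℝ => y * σ),
    Real.map_volume_mul_right hσ.ne', lintegral_smul_measure, abs_of_pos (inv_pos.2 hσ),
    smul_eq_mul]

lemma double (φ : ℝ → ℝ) (hφ : Measurable φ) (h : ℝ → ℝ≥0∞) (hh : Measurable h) :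
    ∫⁻ x, ∫⁻ σ in Ioo (0:ℝ) 1, ‖φ σ‖ₑ * h (x * σ) =
      (∫⁻ σ in Ioo (0:ℝ) 1, ENNReal.ofReal (|φ σ| / σ)) * ∫⁻ x, h x := by
  rw [lintegral_lintegral_swap (by fun_prop), ← lintegral_mul_const _ (by fun_prop)]
  refine setLIntegral_congr_fun measurableSet_Ioo fun σ hσ => ?_
  rw [lintegral_const_mul _ (by fun_prop), lint_scale h hh hσ.1, ← mul_assoc, div_eq_mul_inv,
    ENNReal.ofReal_mul (abs_nonneg _), Real.enorm_eq_ofReal_abs]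

lemma F_int (φ : ℝ → ℝ) (hφ : Measurable φ)
    (hK : IntegrableOn (fun σ => |φ σ| / σ) (Ioo (0:ℝ) 1))
    (f : ℝ → ℝ) (hfm : Measurable f) (hf : Integrable f) :
    Integrable (fun p : ℝ × ℝ => φ p.2 * f (p.1 * p.2))
      (volume.prod (volume.restrict (Ioo (0:ℝ) 1))) := by
  refine ⟨(by fun_prop : Measurable _).aestronglyMeasurable, ?_⟩
  unfold HasFiniteIntegral
  rw [lintegral_prod _ (by fun_prop)]
  simp only [enorm_mul]
  rw [double φ hφ (fun y => ‖f y‖ₑ) hfm.enorm]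
  refine ENNReal.mul_lt_top ?_ hf.2
  exact hK.lintegral_lt_top

lemma conv_T (φ : ℝ → ℝ) (hφ : Measurable φ)
    (hK : IntegrableOn (fun σ => |φ σ| / σ) (Ioo (0:ℝ) 1))
    (f : ℝ → ℝ) (hfm : Measurable f) (hf : Integrable f) {t : ℝ} (ht : 0 < t) (x : ℝ) :
    conv (P t) (fun x => ∫ σ in Ioo (0:ℝ) 1, φ σ * f (x * σ)) x =
      ∫ σ in Ioo (0:ℝ) 1, φ σ * conv (P (t * σ)) f (x * σ) := by
  unfold conv
  simp_rw [← integral_const_mul]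
  rw [integral_integral_swap]
  · refine setIntegral_congr_fun measurableSet_Ioo fun σ hσ => ?_
    have hσ0 := hσ.1
    have hs := Measure.integral_comp_mul_right
      (fun z => φ σ * (P (t * σ) (x * σ - z) * f z)) σ
    rw [smul_eq_mul, abs_of_pos (inv_pos.2 hσ0), eq_inv_mul_iff_mul_eq₀ hσ0.ne',
      ← integral_const_mul] at hs
    rw [← hs]
    congr 1
    funext y
    have : P t (x - y) = σ * P (t * σ) (x * σ - y * σ) := by
      unfold P
      rw [show (t * σ) ^ 2 + (x * σ - y * σ) ^ 2 = σ ^ 2 * (t ^ 2 + (x - y) ^ 2) by ring]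
      have : t ^ 2 + (x - y) ^ 2 ≠ 0 := by positivity
      field_simp
    rw [this]; ring
  · refine (F_int φ hφ hK f hfm hf).bdd_mul (f := fun p : ℝ × ℝ => P t (x - p.1))
      (c := (1 / Real.pi) * t / t ^ 2) ?_ ?_
    · exact ((P_cont ht).comp (by fun_prop : Continuous fun p : ℝ × ℝ => x - p.1)).aestronglyMeasurable
    · refine ae_of_all _ fun p => ?_
      rw [Real.norm_of_nonneg (P_nonneg ht _)]
      exact P_le ht _

lemma MPE_T_le (φ : ℝ → ℝ) (hφ : Measurable φ)
    (hK : IntegrableOn (fun σ => |φ σ| / σ) (Ioo (0:ℝ) 1))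
    (f : ℝ → ℝ) (hfm : Measurable f) (hf : Integrable f) (x : ℝ) :
    MPE (fun x => ∫ σ in Ioo (0:ℝ) 1, φ σ * f (x * σ)) x ≤
      ∫⁻ σ in Ioo (0:ℝ) 1, ‖φ σ‖ₑ * MPE f (x * σ) := by
  refine iSup_le fun t => ?_
  rw [conv_T φ hφ hK f hfm hf t.2, ← Real.enorm_eq_ofReal_abs]
  refine (enorm_integral_le_lintegral_enorm _).trans ?_
  refine setLIntegral_mono' measurableSet_Ioo fun σ hσ => ?_
  rw [enorm_mul]
  gcongr
  rw [Real.enorm_eq_ofReal_abs]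
  exact le_iSup (fun s : {t : ℝ // 0 < t} => ENNReal.ofReal |conv (P s.1) f (x * σ)|)
    ⟨t.1 * σ, mul_pos t.2 hσ.1⟩

lemma main_meas (φ : ℝ → ℝ) (hφ : Measurable φ)
    (hK : IntegrableOn (fun σ => |φ σ| / σ) (Ioo (0:ℝ) 1))
    (f : ℝ → ℝ) (hfm : Measurable f) (hf : Integrable f) (hMP : Integrable (MP f)) :
    Integrable (MP (fun x => ∫ σ in Ioo (0:ℝ) 1, φ σ * f (x * σ))) ∧
    (∫ y, MP (fun x => ∫ σ in Ioo (0:ℝ) 1, φ σ * f (x * σ)) y) ≤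
      (∫ σ in Ioo (0:ℝ) 1, |φ σ| / σ) * ∫ y, MP f y := by
  set g : ℝ → ℝ := fun x => ∫ σ in Ioo (0:ℝ) 1, φ σ * f (x * σ) with hg
  have hgi : Integrable g := (F_int φ hφ hK f hfm hf).integral_prod_left
  have hgm := MPE_meas g hgi
  have hfM := MPE_meas f hf
  have hfin := MPE_finite f hfm hf
  have e1 : MP f = fun x => (MPE f x).toReal := funext (MP_eq f)
  have e2 : MP g = fun x => (MPE g x).toReal := funext (MP_eq g)
  have hle : ∫⁻ x, MPE g x ≤
      (∫⁻ σ in Ioo (0:ℝ) 1, ENNReal.ofReal (|φ σ| / σ)) * ∫⁻ x, MPE f x := by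
    rw [← double φ hφ (MPE f) hfM]
    exact lintegral_mono fun x => MPE_T_le φ hφ hK f hfm hf x
  rw [e1] at hMP
  have hft : ∫⁻ x, MPE f x ≠ ∞ :=
    (integrable_toReal_iff hfM.aemeasurable (hfin.mono fun _ h => h.ne)).1 hMP
  have hKt : ∫⁻ σ in Ioo (0:ℝ) 1, ENNReal.ofReal (|φ σ| / σ) ≠ ∞ := hK.lintegral_lt_top.ne
  have hprod := ENNReal.mul_ne_top hKt hft
  have hgt : ∫⁻ x, MPE g x ≠ ∞ := ne_top_of_le_ne_top hprod hle
  rw [e1, e2]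
  refine ⟨integrable_toReal_of_lintegral_ne_top hgm.aemeasurable hgt, ?_⟩
  rw [integral_toReal hgm.aemeasurable (ae_lt_top hgm hgt), integral_toReal hfM.aemeasurable hfin]
  have hKe : ∫ σ in Ioo (0:ℝ) 1, |φ σ| / σ =
      (∫⁻ σ in Ioo (0:ℝ) 1, ENNReal.ofReal (|φ σ| / σ)).toReal := by
    refine integral_eq_lintegral_of_nonneg_ae ?_ hK.1
    refine (ae_restrict_iff' measurableSet_Ioo).2 (ae_of_all _ fun σ hσ => ?_)
    exact div_nonneg (abs_nonneg _) hσ.1.le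
  rw [hKe, ← ENNReal.toReal_mul]
  exact ENNReal.toReal_mono hprod hle

lemma MP_congr {f g : ℝ → ℝ} (h : f =ᵐ[volume] g) : MP f = MP g := by
  funext x
  unfold MP conv
  congr 1
  funext t
  congr 1
  refine integral_congr_ae ?_
  filter_upwards [h] with y hy
  rw [hy]

end helpers

theorem stmt16 (φ : ℝ → ℝ) (hφ : Measurable φ)
    (hK : IntegrableOn (fun σ => |φ σ| / σ) (Ioo (0:ℝ) 1))
    (f : ℝ → ℝ) (hf : Integrable f) (hMP : Integrable (MP f)) :
    Integrable (MP (fun x => ∫ σ in Ioo (0:ℝ) 1, φ σ * f (x * σ))) ∧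
    (∫ y, MP (fun x => ∫ σ in Ioo (0:ℝ) 1, φ σ * f (x * σ)) y) ≤
      (∫ σ in Ioo (0:ℝ) 1, |φ σ| / σ) * ∫ y, MP f y := by
  have hae := hf.1.ae_eq_mk
  have hT : (fun x => ∫ σ in Ioo (0:ℝ) 1, φ σ * f (x * σ)) =ᵐ[volume]
      (fun x => ∫ σ in Ioo (0:ℝ) 1, φ σ * hf.1.mk f (x * σ)) := by
    filter_upwards [Measure.ae_ne volume (0:ℝ)] with x hx
    refine integral_congr_ae (ae_restrict_of_ae ?_)
    have hq : Measure.QuasiMeasurePreserving (fun σ : ℝ => x * σ) volume volume := by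
      refine ⟨by fun_prop, ?_⟩
      rw [Real.map_volume_mul_left hx]
      exact Measure.smul_absolutelyContinuous
    filter_upwards [hq.ae hae] with σ hσ
    rw [hσ]
  rw [MP_congr hT, MP_congr hae]
  rw [MP_congr hae] at hMP
  exact main_meas φ hφ hK _ hf.1.stronglyMeasurable_mk.measurable (hf.congr hae) hMP
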